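/- There exists a constant c such that for all integers m ≥ 2 and d ≥ 1, the directed hypergrid [m]^d has a 2-TC-spanner with at most c·K·m^d·H_m^{d−1}·d²·(log₂ m)² edges, where H_m = Σ_{i=1}^m 1/i is the m-th harmonic number and K = e^{d/(H_m/2 + 1)}·2^{−d}. -/

import Mathlib

/-- There is a directed walk of length at most `k` from `u` to `v` in the digraph
with edge relation `E`. -/
def distLE {V : Type*} (E : V → V → Prop) : ℕ → V → V → Prop
  | 0 => fun u v => u = v
  | n + 1 => fun u v => u = v ∨ ∃ w, E u w ∧ distLE E n w v

/-- `H` is a `k`-transitive-closure-spanner of the digraph `E`: every edge of `H` is an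
edge of the transitive closure of `E`, and whenever `E` has a directed path from `u` to `v`,
`H` has one of length at most `k`. -/
def IsTCSpanner {V : Type*} (E H : V → V → Prop) (k : ℕ) : Prop :=
  (∀ u v, H u v → u ≠ v ∧ Relation.TransGen E u v) ∧
  (∀ u v, Relation.ReflTransGen E u v → distLE H k u v)

/-- The directed hypergrid `[m]^d` (vertices indexed by `Fin d → Fin m`): an edge from `x`
to `y` iff `y - x` is a standard basis vector, i.e. `y` increments exactly one coordinate of
`x` by one. -/
def hypergridEdge (m d : ℕ) (x y : Fin d → Fin m) : Prop :=
  ∃ t, (y t : ℕ) = (x t : ℕ) + 1 ∧ ∀ s, s ≠ t → x s = y s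


/-- normalised central binomial coefficients -/
noncomputable def cbs (n : ℕ) : ℝ := (Nat.centralBinom n : ℝ) / 4 ^ n

lemma cbs_pos (n : ℕ) : 0 < cbs n := by
  have := Nat.centralBinom_pos n
  unfold cbs; positivity

lemma cbs_zero : cbs 0 = 1 := by simp [cbs]

lemma cbs_succ (n : ℕ) : 2 * ((n : ℝ) + 1) * cbs (n + 1) = (2 * n + 1) * cbs n := by
  have h : ((n : ℝ) + 1) * (Nat.centralBinom (n + 1) : ℝ)
      = 2 * (2 * n + 1) * (Nat.centralBinom n : ℝ) := by
    exact_mod_cast Nat.succ_mul_centralBinom_succ n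
  unfold cbs
  rw [pow_succ]
  field_simp
  linarith

lemma cbs_conv (n : ℕ) : ∑ p ∈ Finset.HasAntidiagonal.antidiagonal n, cbs p.1 * cbs p.2 = 1 := by
  have sym : ∀ n : ℕ, (n : ℝ) * ∑ p ∈ Finset.HasAntidiagonal.antidiagonal n, cbs p.1 * cbs p.2
      = 2 * ∑ p ∈ Finset.HasAntidiagonal.antidiagonal n, (p.1 : ℝ) * (cbs p.1 * cbs p.2) := by
    intro n
    have h1 : ∑ p ∈ Finset.HasAntidiagonal.antidiagonal n, (p.1 : ℝ) * (cbs p.1 * cbs p.2)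
        = ∑ p ∈ Finset.HasAntidiagonal.antidiagonal n, (p.2 : ℝ) * (cbs p.1 * cbs p.2) := by
      rw [← Finset.Nat.sum_antidiagonal_swap]
      apply Finset.sum_congr rfl
      intro p _
      simp [mul_comm (cbs p.2)]
    rw [two_mul]
    nth_rewrite 2 [h1]
    rw [← Finset.sum_add_distrib, Finset.mul_sum]
    apply Finset.sum_congr rfl
    intro p hp
    have : (n : ℝ) = p.1 + p.2 := by
      rw [← Finset.HasAntidiagonal.mem_antidiagonal.mp hp]; push_cast; ring
    rw [this]; ring
  induction n with
  | zero => simp [cbs_zero]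
  | succ n ih =>
    have h := sym (n + 1)
    rw [Finset.Nat.sum_antidiagonal_succ (f := fun p => (p.1 : ℝ) * (cbs p.1 * cbs p.2))] at h
    have h2 : 2 * ∑ p ∈ Finset.HasAntidiagonal.antidiagonal n, ((p.1 + 1 : ℕ) : ℝ) * (cbs (p.1 + 1) * cbs p.2)
        = 2 * ∑ p ∈ Finset.HasAntidiagonal.antidiagonal n, (p.1 : ℝ) * (cbs p.1 * cbs p.2)
          + ∑ p ∈ Finset.HasAntidiagonal.antidiagonal n, cbs p.1 * cbs p.2 := by
      rw [Finset.mul_sum, Finset.mul_sum, ← Finset.sum_add_distrib]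
      apply Finset.sum_congr rfl
      intro p _
      have := cbs_succ p.1
      push_cast
      linear_combination cbs p.2 * this
    simp only [Nat.cast_zero, zero_mul, zero_add] at h
    rw [h2, ← sym n, ih] at h
    push_cast at h
    have hn : (n : ℝ) + 1 ≠ 0 := by positivity
    apply mul_left_cancel₀ hn
    linarith

lemma cbs_sq_le (n : ℕ) : cbs n ^ 2 * (3 * n + 1) ≤ 1 := by
  induction n with
  | zero => simp [cbs_zero]
  | succ n ih =>
    have h := cbs_succ n
    have hn : (0 : ℝ) < 4 * ((n : ℝ) + 1) ^ 2 := by positivity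
    have h2 : 4 * ((n : ℝ) + 1) ^ 2 * cbs (n + 1) ^ 2 = (2 * n + 1) ^ 2 * cbs n ^ 2 := by
      have : (2 * ((n : ℝ) + 1) * cbs (n + 1)) ^ 2 = ((2 * n + 1) * cbs n) ^ 2 := by rw [h]
      linarith [this]
    have h3 : ((2 : ℝ) * n + 1) ^ 2 * (3 * (n + 1) + 1) ≤ 4 * ((n : ℝ) + 1) ^ 2 * (3 * n + 1) := by
      have : (0 : ℝ) ≤ n := by positivity
      nlinarith
    have h4 : 4 * ((n : ℝ) + 1) ^ 2 * (cbs (n + 1) ^ 2 * (3 * ((n : ℝ) + 1) + 1))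
        ≤ 4 * ((n : ℝ) + 1) ^ 2 * 1 := by
      calc 4 * ((n : ℝ) + 1) ^ 2 * (cbs (n + 1) ^ 2 * (3 * ((n : ℝ) + 1) + 1))
          = (((2 : ℝ) * n + 1) ^ 2 * (3 * (n + 1) + 1)) * cbs n ^ 2 := by
            linear_combination (3 * ((n : ℝ) + 1) + 1) * h2
        _ ≤ (4 * ((n : ℝ) + 1) ^ 2 * (3 * n + 1)) * cbs n ^ 2 := by gcongr
        _ = 4 * ((n : ℝ) + 1) ^ 2 * (cbs n ^ 2 * (3 * n + 1)) := by ring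
        _ ≤ _ := by gcongr
    push_cast
    exact le_of_mul_le_mul_left h4 hn

/-- sum of the squares against the harmonic number -/
lemma cbs_sum_le (m : ℕ) (hm : 2 ≤ m) :
    ∑ j ∈ Finset.range m, cbs j ^ 2 ≤
      0.485 * (∑ i ∈ Finset.Icc 1 m, (1 : ℝ) / i) + 0.5225 := by
  induction m, hm using Nat.le_induction with
  | base =>
    have h1 := cbs_succ 0
    have : cbs 1 = 1 / 2 := by
      norm_num [cbs_zero] at h1; linarith
    simp [Finset.sum_range_succ, Finset.sum_Icc_succ_top, cbs_zero, this]
    norm_num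
  | succ m hm ih =>
    rw [Finset.sum_range_succ, Finset.sum_Icc_succ_top (by omega)]
    have h := cbs_sq_le m
    have hm' : (2 : ℝ) ≤ m := by exact_mod_cast hm
    have : cbs m ^ 2 ≤ 0.485 * ((1 : ℝ) / ((m + 1 : ℕ) : ℝ)) := by
      have h1 : cbs m ^ 2 ≤ 1 / (3 * m + 1) := by
        rw [le_div_iff₀ (by positivity)]; exact h
      refine h1.trans ?_
      push_cast
      rw [mul_one_div, div_le_div_iff₀ (by positivity) (by positivity)]
      nlinarith
    linarith

lemma harm_ge (m : ℕ) (hm : 2 ≤ m) : (1.5 : ℝ) ≤ ∑ i ∈ Finset.Icc 1 m, (1 : ℝ) / i := by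
  induction m, hm using Nat.le_induction with
  | base => simp [Finset.sum_Icc_succ_top]; norm_num
  | succ m hm ih =>
    rw [Finset.sum_Icc_succ_top (by omega)]
    have : (0 : ℝ) ≤ 1 / ((m + 1 : ℕ) : ℝ) := by positivity
    linarith

lemma harm_le (m : ℕ) : ∑ i ∈ Finset.Icc 1 m, (1 : ℝ) / i ≤ 1 + Real.log m := by
  have h := harmonic_le_one_add_log m
  rw [harmonic_eq_sum_Icc] at h
  push_cast at h
  simpa using h

lemma slack (h : ℝ) (hh : 1.5 ≤ h) :
    0.485 * h + 0.5225 ≤ 0.97 * (h / 2 * Real.exp (1 / (h / 2 + 1))) := by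
  have e := Real.quadratic_le_exp_of_nonneg (x := 1 / (h / 2 + 1)) (by positivity)
  have : 0.485 * h + 0.5225 ≤ 0.97 * (h / 2 * (1 + 1 / (h / 2 + 1) + (1 / (h / 2 + 1)) ^ 2 / 2)) := by
    have hp : 0 < h / 2 + 1 := by linarith
    field_simp
    nlinarith [mul_nonneg (sub_nonneg.2 hh) (sub_nonneg.2 hh), pow_nonneg (sub_nonneg.2 hh) 3]
  refine this.trans ?_
  gcongr

/-- fourth root -/
noncomputable def frt (n : ℕ) : ℝ := √(√(n : ℝ))

lemma frt_pow (n : ℕ) : frt n ^ 4 = n := by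
  unfold frt
  have : √(√(n : ℝ)) ^ 4 = (√(√(n : ℝ)) ^ 2) ^ 2 := by ring
  rw [this, Real.sq_sqrt (by positivity), Real.sq_sqrt (by positivity)]

lemma frt_nonneg (n : ℕ) : 0 ≤ frt n := Real.sqrt_nonneg _

lemma frt_pos (n : ℕ) : 0 < frt (n + 1) := by
  unfold frt; positivity

lemma frt_mono {a b : ℕ} (h : a ≤ b) : frt a ≤ frt b := by
  unfold frt; gcongr

lemma frt_step (n : ℕ) : 1 / frt (n + 1) ^ 3 ≤ 4 * (frt (n + 1) - frt n) := by
  have h1 := frt_pow (n + 1)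
  have h2 := frt_pow n
  have ha := frt_nonneg n
  have hb := frt_pos n
  have hab := frt_mono (Nat.le_succ n)
  simp only [Nat.succ_eq_add_one] at hab
  push_cast at h1
  rw [div_le_iff₀ (by positivity)]
  set a := frt n
  set b := frt (n + 1)
  have : (b - a) * (b ^ 3 + b ^ 2 * a + b * a ^ 2 + a ^ 3) = 1 := by linear_combination h1 - h2
  have h5 : b ^ 3 + b ^ 2 * a + b * a ^ 2 + a ^ 3 ≤ 4 * b ^ 3 := by
    have : b ^ 2 * a ≤ b ^ 2 * b := by gcongr
    have : b * a ^ 2 ≤ b * b ^ 2 := by gcongr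
    have : a ^ 3 ≤ b ^ 3 := by gcongr
    nlinarith
  nlinarith [mul_le_mul_of_nonneg_left h5 (sub_nonneg.2 hab)]

lemma frt_step' (n : ℕ) : 1 / frt (n + 1) ≤ 4 * (frt (n + 1) ^ 3 - frt n ^ 3) := by
  have ha := frt_nonneg n
  have hb := frt_pos n
  have hab := frt_mono (Nat.le_succ n)
  simp only [Nat.succ_eq_add_one] at hab
  have h := frt_step n
  rw [div_le_iff₀ (by positivity)] at h ⊢
  set a := frt n
  set b := frt (n + 1)
  have h2 : (b - a) * b ^ 2 ≤ b ^ 3 - a ^ 3 := by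
    have : b ^ 3 - a ^ 3 = (b - a) * b ^ 2 + (b - a) * (a * b + a ^ 2) := by ring
    have : 0 ≤ (b - a) * (a * b + a ^ 2) := mul_nonneg (sub_nonneg.2 hab) (by positivity)
    linarith
  have := mul_le_mul_of_nonneg_right h2 hb.le
  nlinarith

lemma frt_sum (n : ℕ) : ∑ i ∈ Finset.range n, 1 / frt (i + 1) ^ 3 ≤ 4 * frt n := by
  induction n with
  | zero => simp [frt]
  | succ n ih =>
    rw [Finset.sum_range_succ]
    linarith [frt_step n]

lemma frt_sum' (n : ℕ) : ∑ i ∈ Finset.range n, 1 / frt (i + 1) ≤ 4 * frt n ^ 3 := by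
  induction n with
  | zero => simp [frt]
  | succ n ih =>
    rw [Finset.sum_range_succ]
    linarith [frt_step' n]

lemma frt_conv (n : ℕ) :
    ∑ p ∈ Finset.HasAntidiagonal.antidiagonal n, 1 / (frt (p.1 + 1) ^ 3 * frt (p.2 + 1)) ≤ 40 := by
  have hN := frt_pos n
  set N := frt (n + 1) with hNdef
  have key : ∀ p ∈ Finset.HasAntidiagonal.antidiagonal n, 1 / (frt (p.1 + 1) ^ 3 * frt (p.2 + 1)) ≤
      2 / N * (1 / frt (p.1 + 1) ^ 3) + 8 / N ^ 3 * (1 / frt (p.2 + 1)) := by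
    intro p hp
    have hp' := Finset.HasAntidiagonal.mem_antidiagonal.mp hp
    have h1 := frt_pos p.1
    have h2 := frt_pos p.2
    have big : ∀ k : ℕ, n ≤ 2 * k → N ≤ 2 * frt (k + 1) := by
      intro k hk
      have h3 := frt_pos k
      apply le_of_pow_le_pow_left₀ (n := 4) (by norm_num) (by positivity)
      rw [mul_pow, hNdef, frt_pow, frt_pow]
      have : (n : ℝ) ≤ 2 * k := by exact_mod_cast hk
      push_cast
      linarith
    rcases le_total p.1 p.2 with h | h
    · have h3 := big p.2 (by omega)
      have : 1 / (frt (p.1 + 1) ^ 3 * frt (p.2 + 1)) ≤ 2 / N * (1 / frt (p.1 + 1) ^ 3) := by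
        rw [div_mul_div_comm, div_le_div_iff₀ (by positivity) (by positivity)]
        have := mul_le_mul_of_nonneg_left h3 (pow_nonneg h1.le 3)
        nlinarith
      have : 0 ≤ 8 / N ^ 3 * (1 / frt (p.2 + 1)) := by positivity
      linarith
    · have h3 := big p.1 (by omega)
      have h4 : N ^ 3 ≤ 8 * frt (p.1 + 1) ^ 3 := by
        calc N ^ 3 ≤ (2 * frt (p.1 + 1)) ^ 3 := by gcongr
          _ = _ := by ring
      have : 1 / (frt (p.1 + 1) ^ 3 * frt (p.2 + 1)) ≤ 8 / N ^ 3 * (1 / frt (p.2 + 1)) := by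
        rw [div_mul_div_comm, div_le_div_iff₀ (by positivity) (by positivity)]
        have := mul_le_mul_of_nonneg_left h4 h2.le
        nlinarith
      have : 0 ≤ 2 / N * (1 / frt (p.1 + 1) ^ 3) := by positivity
      linarith
  refine (Finset.sum_le_sum key).trans ?_
  rw [Finset.sum_add_distrib, ← Finset.mul_sum, ← Finset.mul_sum]
  have e1 : ∑ p ∈ Finset.HasAntidiagonal.antidiagonal n, 1 / frt (p.1 + 1) ^ 3
      = ∑ i ∈ Finset.range (n + 1), 1 / frt (i + 1) ^ 3 :=
    Finset.Nat.sum_antidiagonal_eq_sum_range_succ (fun i _ => 1 / frt (i + 1) ^ 3) n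
  have e2 : ∑ p ∈ Finset.HasAntidiagonal.antidiagonal n, 1 / frt (p.2 + 1)
      = ∑ i ∈ Finset.range (n + 1), 1 / frt (i + 1) := by
    rw [← Finset.Nat.sum_antidiagonal_swap]
    exact Finset.Nat.sum_antidiagonal_eq_sum_range_succ (fun i _ => 1 / frt (i + 1)) n
  rw [e1, e2]
  have b1 := frt_sum (n + 1)
  have b2 := frt_sum' (n + 1)
  rw [← hNdef] at b1 b2
  have c1 := mul_le_mul_of_nonneg_left b1 (show 0 ≤ 2 / N by positivity)
  have c2 := mul_le_mul_of_nonneg_left b2 (show 0 ≤ 8 / N ^ 3 by positivity)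
  have d1 : 2 / N * (4 * N) = 8 := by field_simp; norm_num
  have d2 : 8 / N ^ 3 * (4 * N ^ 3) = 32 := by field_simp; norm_num
  linarith

lemma log_sq_le (t : ℝ) (ht : 0 < t) : Real.log t ^ 2 ≤ 4 * (t + 1 / t) := by
  have hs : 0 < √t := Real.sqrt_pos.2 ht
  have h1 := Real.log_le_sub_one_of_pos hs
  have h2 := Real.log_le_sub_one_of_pos (inv_pos.2 hs)
  rw [Real.log_inv] at h2
  have h3 : Real.log t = 2 * Real.log √t := by
    rw [Real.log_sqrt ht.le]; ring
  have hst : t = √t ^ 2 := (Real.sq_sqrt ht.le).symm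
  have hit : 1 / t = (√t)⁻¹ ^ 2 := by rw [inv_pow, ← hst, one_div]
  have hi : 0 < (√t)⁻¹ := by positivity
  rw [h3, hit]
  have goal : (2 * Real.log √t) ^ 2 ≤ 4 * (√t ^ 2 + (√t)⁻¹ ^ 2) := by
    rcases le_total 0 (Real.log √t) with h | h
    · nlinarith [sq_nonneg ((√t)⁻¹)]
    · nlinarith [sq_nonneg (√t)]
  rwa [← hst] at goal

lemma cbs_var (n : ℕ) : ∑ p ∈ Finset.HasAntidiagonal.antidiagonal n, cbs p.1 * cbs p.2 *
    (Real.log (cbs p.1 ^ 2) - Real.log (cbs p.2 ^ 2)) ^ 2 ≤ 5120 := by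
  have hle : ∀ i, √(cbs i) ≤ 1 / frt (i + 1) := by
    intro i
    have h := cbs_sq_le i
    have hp := frt_pos i
    rw [le_div_iff₀ hp]
    have h0 := cbs_pos i
    have h2 : √(cbs i) ^ 4 = cbs i ^ 2 := by
      have : √(cbs i) ^ 4 = (√(cbs i) ^ 2) ^ 2 := by ring
      rw [this, Real.sq_sqrt h0.le]
    apply le_of_pow_le_pow_left₀ (n := 4) (by norm_num) (by positivity)
    rw [mul_pow, h2, frt_pow]
    have : cbs i ^ 2 * ((i + 1 : ℕ) : ℝ) ≤ cbs i ^ 2 * (3 * i + 1) := by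
      gcongr
      push_cast
      have : (0 : ℝ) ≤ i := by positivity
      linarith
    simp only [one_pow]
    linarith
  have key : ∀ p ∈ Finset.HasAntidiagonal.antidiagonal n, cbs p.1 * cbs p.2 *
      (Real.log (cbs p.1 ^ 2) - Real.log (cbs p.2 ^ 2)) ^ 2 ≤
      64 * (1 / (frt (p.1 + 1) ^ 3 * frt (p.2 + 1)))
        + 64 * (1 / (frt (p.2 + 1) ^ 3 * frt (p.1 + 1))) := by
    intro p _
    have h1 := cbs_pos p.1
    have h2 := cbs_pos p.2
    have l1 := hle p.1
    have l2 := hle p.2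
    have f1 := frt_pos p.1
    have f2 := frt_pos p.2
    have g1 : 0 < √(cbs p.1) := Real.sqrt_pos.2 h1
    have g2 : 0 < √(cbs p.2) := Real.sqrt_pos.2 h2
    have q1 : cbs p.1 = √(cbs p.1) ^ 2 := (Real.sq_sqrt h1.le).symm
    have q2 : cbs p.2 = √(cbs p.2) ^ 2 := (Real.sq_sqrt h2.le).symm
    have hl := log_sq_le (√(cbs p.1) / √(cbs p.2)) (by positivity)
    rw [Real.log_div g1.ne' g2.ne'] at hl
    set a := √(cbs p.1)
    set b := √(cbs p.2)
    rw [q1, q2]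
    have : (Real.log ((a ^ 2) ^ 2) - Real.log ((b ^ 2) ^ 2)) ^ 2
        = 16 * (Real.log a - Real.log b) ^ 2 := by
      simp only [Real.log_pow]; push_cast; ring
    rw [this]
    calc a ^ 2 * b ^ 2 * (16 * (Real.log a - Real.log b) ^ 2)
        ≤ a ^ 2 * b ^ 2 * (16 * (4 * (a / b + 1 / (a / b)))) := by gcongr
      _ = 64 * (a ^ 3 * b) + 64 * (b ^ 3 * a) := by field_simp; norm_num
      _ ≤ 64 * ((1 / frt (p.1 + 1)) ^ 3 * (1 / frt (p.2 + 1)))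
          + 64 * ((1 / frt (p.2 + 1)) ^ 3 * (1 / frt (p.1 + 1))) := by gcongr
      _ = _ := by simp only [div_pow, one_pow, div_mul_div_comm, one_mul]
  refine (Finset.sum_le_sum key).trans ?_
  rw [Finset.sum_add_distrib, ← Finset.mul_sum, ← Finset.mul_sum]
  have e : ∑ p ∈ Finset.HasAntidiagonal.antidiagonal n, 1 / (frt (p.2 + 1) ^ 3 * frt (p.1 + 1))
      = ∑ p ∈ Finset.HasAntidiagonal.antidiagonal n, 1 / (frt (p.1 + 1) ^ 3 * frt (p.2 + 1)) := by
    rw [← Finset.Nat.sum_antidiagonal_swap]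
    rfl
  rw [e]
  linarith [frt_conv n]

lemma cbs_mean (n : ℕ) : ∑ p ∈ Finset.HasAntidiagonal.antidiagonal n, cbs p.1 * cbs p.2 *
    (Real.log (cbs p.1 ^ 2) - Real.log (cbs p.2 ^ 2)) = 0 := by
  have e : ∑ p ∈ Finset.HasAntidiagonal.antidiagonal n, cbs p.1 * cbs p.2 *
    (Real.log (cbs p.1 ^ 2) - Real.log (cbs p.2 ^ 2)) =
    - ∑ p ∈ Finset.HasAntidiagonal.antidiagonal n, cbs p.1 * cbs p.2 *
    (Real.log (cbs p.1 ^ 2) - Real.log (cbs p.2 ^ 2)) := by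
    nth_rewrite 1 [← Finset.Nat.sum_antidiagonal_swap]
    rw [← Finset.sum_neg_distrib]
    apply Finset.sum_congr rfl
    intro p _
    simp only [Prod.fst_swap, Prod.snd_swap]
    ring
  linarith

lemma harm_sub (n k : ℕ) (hk : k ≤ n) (hn : 0 < n) :
    (k : ℝ) / n + ((harmonic (n - k) : ℚ) : ℝ) ≤ ((harmonic n : ℚ) : ℝ) := by
  induction k with
  | zero => simp
  | succ k ih =>
    have ih := ih (by omega)
    obtain ⟨r, hr⟩ : ∃ r, n - k = r + 1 := ⟨n - k - 1, by omega⟩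
    have hr' : n - (k + 1) = r := by omega
    rw [hr, harmonic_succ] at ih
    rw [hr']
    push_cast at ih ⊢
    have : (1 : ℝ) / n ≤ ((r : ℝ) + 1)⁻¹ := by
      rw [← one_div]
      have : (r : ℝ) + 1 ≤ n := by exact_mod_cast (by omega : r + 1 ≤ n)
      gcongr
    rw [add_div]
    linarith

lemma count_le (D a : ℕ) (h : a ≤ D) :
    ∑ t ∈ Finset.Icc 1 D, (if t ≤ a then (1 : ℝ) else 0) = a := by
  rw [← Finset.sum_filter]
  have : (Finset.Icc 1 D).filter (fun t => t ≤ a) = Finset.Icc 1 a := by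
    ext t; simp only [Finset.mem_filter, Finset.mem_Icc]; omega
  rw [this]; simp

lemma greedy {V : Type*} [Fintype V] [DecidableEq V] (c : V → V → ℕ) (B : ℝ) (hB : 0 < B) :
    ∀ n, ∀ U : Finset (V × V), U.card = n →
      (∀ p ∈ U, B ≤ ∑ z, ((min (c p.1 z) (c z p.2) : ℕ) : ℝ)) →
      ∃ E : Finset (V × V), (∀ e ∈ E, 0 < c e.1 e.2) ∧
        (∀ p ∈ U, ∃ z, (p.1, z) ∈ E ∧ (z, p.2) ∈ E) ∧
        (E.card : ℝ) ≤ 2 * (∑ x, ∑ z, (c x z : ℝ)) / B * ((harmonic n : ℚ) : ℝ) := by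
  intro n
  induction n using Nat.strong_induction_on with
  | _ n ih =>
  intro U hU hcov
  rcases Nat.eq_zero_or_pos n with rfl | hn
  · refine ⟨∅, by simp, ?_, by simp⟩
    rw [Finset.card_eq_zero] at hU
    simp [hU]
  set C : ℝ := ∑ x, ∑ z, (c x z : ℝ) with hC
  have hC0 : 0 ≤ C := by positivity
  let D : ℕ := ∑ x, ∑ z, c x z
  have hD : ∀ x z, c x z ≤ D := by
    intro x z
    calc c x z ≤ ∑ z, c x z := Finset.single_le_sum (f := fun z => c x z) (by simp) (Finset.mem_univ z)
      _ ≤ D := Finset.single_le_sum (f := fun x => ∑ z, c x z) (by simp) (Finset.mem_univ x)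
  let star : V → ℕ → Finset (V × V) := fun z t =>
    (Finset.univ.filter (fun x => t ≤ c x z)).image (fun x => (x, z)) ∪
    (Finset.univ.filter (fun y => t ≤ c z y)).image (fun y => (z, y))
  let cov : V → ℕ → Finset (V × V) := fun z t =>
    U.filter (fun p => t ≤ c p.1 z ∧ t ≤ c z p.2)
  have hstar : ∑ z, ∑ t ∈ Finset.Icc 1 D, ((star z t).card : ℝ) ≤ 2 * C := by
    have h1 : ∀ z t, ((star z t).card : ℝ) ≤
        ∑ x, (if t ≤ c x z then (1 : ℝ) else 0) + ∑ y, (if t ≤ c z y then (1 : ℝ) else 0) := by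
      intro z t
      have h2 : (star z t).card ≤ (Finset.univ.filter (fun x => t ≤ c x z)).card
          + (Finset.univ.filter (fun y => t ≤ c z y)).card :=
        (Finset.card_union_le _ _).trans (add_le_add Finset.card_image_le Finset.card_image_le)
      rw [Finset.card_filter, Finset.card_filter] at h2
      exact_mod_cast h2
    calc ∑ z, ∑ t ∈ Finset.Icc 1 D, ((star z t).card : ℝ)
        ≤ ∑ z, ∑ t ∈ Finset.Icc 1 D, (∑ x, (if t ≤ c x z then (1 : ℝ) else 0)
            + ∑ y, (if t ≤ c z y then (1 : ℝ) else 0)) :=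
          Finset.sum_le_sum fun z _ => Finset.sum_le_sum fun t _ => h1 z t
      _ = ∑ z, (∑ x, (c x z : ℝ) + ∑ y, (c z y : ℝ)) := by
          apply Finset.sum_congr rfl
          intro z _
          rw [Finset.sum_add_distrib, Finset.sum_comm]
          congr 1
          · exact Finset.sum_congr rfl fun x _ => count_le D _ (hD _ _)
          · rw [Finset.sum_comm]
            exact Finset.sum_congr rfl fun x _ => count_le D _ (hD _ _)
      _ = 2 * C := by
          rw [Finset.sum_add_distrib, Finset.sum_comm]
          ring
  have hcovsum : n * B ≤ ∑ z, ∑ t ∈ Finset.Icc 1 D, ((cov z t).card : ℝ) := by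
    have h1 : ∀ z t, ((cov z t).card : ℝ) =
        ∑ p ∈ U, (if t ≤ min (c p.1 z) (c z p.2) then (1 : ℝ) else 0) := by
      intro z t
      simp only [cov, Finset.card_filter, le_min_iff]
      push_cast
      rfl
    calc (n : ℝ) * B = ∑ p ∈ U, B := by rw [Finset.sum_const, hU, nsmul_eq_mul]
      _ ≤ ∑ p ∈ U, ∑ z, ((min (c p.1 z) (c z p.2) : ℕ) : ℝ) := Finset.sum_le_sum hcov
      _ = ∑ z, ∑ p ∈ U, ((min (c p.1 z) (c z p.2) : ℕ) : ℝ) := Finset.sum_comm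
      _ = _ := by
          apply Finset.sum_congr rfl
          intro z _
          simp only [h1]
          rw [Finset.sum_comm]
          apply Finset.sum_congr rfl
          intro p _
          rw [count_le D _ ((min_le_left _ _).trans (hD _ _))]
  have hn' : (0 : ℝ) < n := by exact_mod_cast hn
  have hnB : 0 < n * B := by positivity
  obtain ⟨z, t, ht, hne, hle⟩ : ∃ z t, t ∈ Finset.Icc 1 D ∧ (cov z t).Nonempty ∧
      ((star z t).card : ℝ) * (n * B) ≤ 2 * C * (cov z t).card := by
    by_contra hcon
    push Not at hcon
    have hge : ∀ z, ∀ t ∈ Finset.Icc 1 D,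
        2 * C * ((cov z t).card : ℝ) ≤ ((star z t).card : ℝ) * (n * B) := by
      intro z t ht
      rcases Finset.eq_empty_or_nonempty (cov z t) with h | h
      · rw [h]; simp; positivity
      · exact (hcon z t ht h).le
    have hex : ∃ z, ∃ t ∈ Finset.Icc 1 D, (cov z t).Nonempty := by
      by_contra hno
      push Not at hno
      have : ∑ z, ∑ t ∈ Finset.Icc 1 D, ((cov z t).card : ℝ) = 0 := by
        apply Finset.sum_eq_zero
        intro z _
        apply Finset.sum_eq_zero
        intro t ht
        simp [hno z t ht]
      linarith
    obtain ⟨z₀, t₀, ht₀, hne⟩ := hex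
    have hlt : ∑ z, ∑ t ∈ Finset.Icc 1 D, 2 * C * ((cov z t).card : ℝ)
        < ∑ z, ∑ t ∈ Finset.Icc 1 D, ((star z t).card : ℝ) * (n * B) := by
      apply Finset.sum_lt_sum
      · intro z _; exact Finset.sum_le_sum (hge z)
      · exact ⟨z₀, Finset.mem_univ _, Finset.sum_lt_sum (hge z₀) ⟨t₀, ht₀, hcon z₀ t₀ ht₀ hne⟩⟩
    simp only [← Finset.mul_sum, ← Finset.sum_mul] at hlt
    have := mul_le_mul_of_nonneg_right hstar hnB.le
    have := mul_le_mul_of_nonneg_left hcovsum (show 0 ≤ 2 * C by positivity)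
    linarith
  have hsub : cov z t ⊆ U := Finset.filter_subset _ _
  have hcard : (U \ cov z t).card = n - (cov z t).card := by
    rw [Finset.card_sdiff_of_subset hsub, hU]
  have hkn : (cov z t).card ≤ n := hU ▸ Finset.card_le_card hsub
  have hkpos : 0 < (cov z t).card := hne.card_pos
  obtain ⟨E, hE1, hE2, hE3⟩ := ih (n - (cov z t).card) (by omega) (U \ cov z t) hcard
    (fun p hp => hcov p (Finset.mem_sdiff.mp hp).1)
  refine ⟨star z t ∪ E, ?_, ?_, ?_⟩
  · intro e he
    have ht1 := (Finset.mem_Icc.mp ht).1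
    rcases Finset.mem_union.mp he with h | h
    · rcases Finset.mem_union.mp h with h | h
      · obtain ⟨x, hx, rfl⟩ := Finset.mem_image.mp h
        have := (Finset.mem_filter.mp hx).2
        exact lt_of_lt_of_le ht1 this
      · obtain ⟨x, hx, rfl⟩ := Finset.mem_image.mp h
        have := (Finset.mem_filter.mp hx).2
        exact lt_of_lt_of_le ht1 this
    · exact hE1 e h
  · intro p hp
    by_cases h : p ∈ cov z t
    · have h2 := (Finset.mem_filter.mp h).2
      refine ⟨z, ?_, ?_⟩
      · apply Finset.mem_union_left
        apply Finset.mem_union_left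
        exact Finset.mem_image.mpr ⟨p.1, by simpa using h2.1, rfl⟩
      · apply Finset.mem_union_left
        apply Finset.mem_union_right
        exact Finset.mem_image.mpr ⟨p.2, by simpa using h2.2, rfl⟩
    · obtain ⟨w, h1, h2⟩ := hE2 p (Finset.mem_sdiff.mpr ⟨hp, h⟩)
      exact ⟨w, Finset.mem_union_right _ h1, Finset.mem_union_right _ h2⟩
  · have h1 : ((star z t ∪ E).card : ℝ) ≤ (star z t).card + E.card := by
      exact_mod_cast Finset.card_union_le _ _
    have h2 : ((star z t).card : ℝ) ≤ 2 * C / B * ((cov z t).card / n) := by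
      rw [div_mul_div_comm, le_div_iff₀ (by positivity)]
      linarith
    have h3 := mul_le_mul_of_nonneg_left (harm_sub n _ hkn hn) (show 0 ≤ 2 * C / B by positivity)
    rw [mul_add] at h3
    linarith

lemma second_moment {ι κ : Type*} [Fintype ι] [DecidableEq ι] [Fintype κ] [DecidableEq κ]
    (p δ : ι → κ → ℝ)
    (h1 : ∀ i, ∑ j, p i j = 1) (h2 : ∀ i, ∑ j, p i j * δ i j = 0) (W : ℝ)
    (h3 : ∀ i, ∑ j, p i j * δ i j ^ 2 ≤ W) :
    ∑ z : ι → κ, (∏ i, p i (z i)) * (∑ i, δ i (z i)) ^ 2 ≤ Fintype.card ι * W := by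
  have expand : ∀ z : ι → κ, (∏ i, p i (z i)) * (∑ i, δ i (z i)) ^ 2
      = ∑ a, ∑ b, ∏ i, (p i (z i) * ((if i = a then δ i (z i) else 1)
          * (if i = b then δ i (z i) else 1))) := by
    intro z
    rw [sq, Finset.sum_mul_sum, Finset.mul_sum]
    apply Finset.sum_congr rfl
    intro a _
    rw [Finset.mul_sum]
    apply Finset.sum_congr rfl
    intro b _
    rw [Finset.prod_mul_distrib, Finset.prod_mul_distrib]
    simp
  simp only [expand]
  rw [Finset.sum_comm]
  have inner : ∀ a, ∑ z : ι → κ, ∑ b, ∏ i, (p i (z i) * ((if i = a then δ i (z i) else 1)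
          * (if i = b then δ i (z i) else 1))) ≤ W := by
    intro a
    rw [Finset.sum_comm]
    have fac : ∀ b, ∑ z : ι → κ, ∏ i, (p i (z i) * ((if i = a then δ i (z i) else 1)
          * (if i = b then δ i (z i) else 1)))
        = ∏ i, ∑ j, (p i j * ((if i = a then δ i j else 1) * (if i = b then δ i j else 1))) := by
      intro b
      rw [Finset.prod_univ_sum]
      simp
    simp only [fac]
    rw [Finset.sum_eq_single a]
    · rw [Finset.prod_eq_single a]
      · simpa [← sq] using h3 a
      · intro i _ hi
        simp [hi, h1]
      · simp
    · intro b _ hb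
      apply Finset.prod_eq_zero (Finset.mem_univ a)
      simp [Ne.symm hb, h2]
    · simp
  calc _ ≤ ∑ a : ι, W := Finset.sum_le_sum fun a _ => inner a
    _ = _ := by simp

lemma exp_moment {ι κ : Type*} [Fintype ι] [DecidableEq ι] [Fintype κ] [DecidableEq κ]
    [Nonempty ι]
    (p δ : ι → κ → ℝ) (h0 : ∀ i j, 0 ≤ p i j)
    (h1 : ∀ i, ∑ j, p i j = 1) (h2 : ∀ i, ∑ j, p i j * δ i j = 0) (W : ℝ)
    (h3 : ∀ i, ∑ j, p i j * δ i j ^ 2 ≤ W) :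
    Real.exp (-((W + 1) / 4 * √(Fintype.card ι))) ≤
      ∑ z : ι → κ, (∏ i, p i (z i)) * Real.exp (-(|∑ i, δ i (z i)| / 2)) := by
  have hm := second_moment p δ h1 h2 W h3
  set K := √(Fintype.card ι : ℝ) with hK
  have hKpos : 0 < K := Real.sqrt_pos.2 (by exact_mod_cast Fintype.card_pos)
  have hK2 : K ^ 2 = Fintype.card ι := Real.sq_sqrt (by positivity)
  have htot : ∑ z : ι → κ, ∏ i, p i (z i) = 1 := by
    have := Finset.prod_univ_sum (fun _ : ι => (Finset.univ : Finset κ)) p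
    simp only [Fintype.piFinset_univ] at this
    rw [← this]; simp [h1]
  set a := (W + 1) / 4 * K with ha
  have key : ∀ z : ι → κ, (∏ i, p i (z i)) * (Real.exp (-a) *
      (1 + a - K / 4 - (∑ i, δ i (z i)) ^ 2 / (4 * K))) ≤
      (∏ i, p i (z i)) * Real.exp (-(|∑ i, δ i (z i)| / 2)) := by
    intro z
    apply mul_le_mul_of_nonneg_left _ (Finset.prod_nonneg fun i _ => h0 i _)
    set u := ∑ i, δ i (z i)
    have e1 := Real.add_one_le_exp (a - |u| / 2)
    have e2 : Real.exp (-(|u| / 2)) = Real.exp (-a) * Real.exp (a - |u| / 2) := by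
      rw [← Real.exp_add]; congr 1; ring
    rw [e2]
    apply mul_le_mul_of_nonneg_left _ (Real.exp_pos _).le
    have : |u| / 2 ≤ K / 4 + u ^ 2 / (4 * K) := by
      have : K / 4 + u ^ 2 / (4 * K) - |u| / 2 = (|u| - K) ^ 2 / (4 * K) := by
        rw [← sq_abs u]; field_simp; ring
      have : 0 ≤ (|u| - K) ^ 2 / (4 * K) := by positivity
      linarith
    linarith
  refine le_trans ?_ (Finset.sum_le_sum fun z _ => key z)
  have e : ∑ z : ι → κ, (∏ i, p i (z i)) * (Real.exp (-a) *
      (1 + a - K / 4 - (∑ i, δ i (z i)) ^ 2 / (4 * K)))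
      = Real.exp (-a) * ((1 + a - K / 4) * ∑ z : ι → κ, ∏ i, p i (z i)
        - (∑ z : ι → κ, (∏ i, p i (z i)) * (∑ i, δ i (z i)) ^ 2) / (4 * K)) := by
    rw [Finset.mul_sum, Finset.sum_div, ← Finset.sum_sub_distrib, Finset.mul_sum]
    apply Finset.sum_congr rfl
    intro z _
    ring
  rw [e, htot]
  have : (∑ z : ι → κ, (∏ i, p i (z i)) * (∑ i, δ i (z i)) ^ 2) / (4 * K) ≤ W * K / 4 := by
    rw [div_le_iff₀ (by positivity)]
    rw [← hK2] at hm
    linarith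
  have h5 : 1 ≤ (1 + a - K / 4) * 1
        - (∑ z : ι → κ, (∏ i, p i (z i)) * (∑ i, δ i (z i)) ^ 2) / (4 * K) := by
    rw [ha]; linarith
  have := mul_le_mul_of_nonneg_left h5 (Real.exp_pos (-a)).le
  linarith

lemma min_ge {ι : Type*} [Fintype ι] (a b : ι → ℝ) (ha : ∀ i, 0 ≤ a i) (hb : ∀ i, 0 ≤ b i) :
    (∏ i, a i * b i) * Real.exp (-(|∑ i, (Real.log (a i ^ 2) - Real.log (b i ^ 2))| / 2)) ≤
      min (∏ i, a i ^ 2) (∏ i, b i ^ 2) := by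
  by_cases h : ∀ i, 0 < a i ∧ 0 < b i
  · set u := ∑ i, (Real.log (a i ^ 2) - Real.log (b i ^ 2)) with hu
    have e1 : ∏ i, a i ^ 2 = (∏ i, a i * b i) * Real.exp (u / 2) := by
      rw [hu, Finset.sum_div, Real.exp_sum, ← Finset.prod_mul_distrib]
      apply Finset.prod_congr rfl
      intro i _
      have ⟨p, q⟩ := h i
      have : (Real.log (a i ^ 2) - Real.log (b i ^ 2)) / 2 = Real.log (a i / b i) := by
        rw [Real.log_div p.ne' q.ne', Real.log_pow, Real.log_pow]; push_cast; ring
      rw [this, Real.exp_log (by positivity)]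
      field_simp
    have e2 : ∏ i, b i ^ 2 = (∏ i, a i * b i) * Real.exp (-u / 2) := by
      rw [hu, ← Finset.sum_neg_distrib, Finset.sum_div, Real.exp_sum, ← Finset.prod_mul_distrib]
      apply Finset.prod_congr rfl
      intro i _
      have ⟨p, q⟩ := h i
      have : -(Real.log (a i ^ 2) - Real.log (b i ^ 2)) / 2 = Real.log (b i / a i) := by
        rw [Real.log_div q.ne' p.ne', Real.log_pow, Real.log_pow]; push_cast; ring
      rw [this, Real.exp_log (by positivity)]
      field_simp
    rw [e1, e2]
    have hp : 0 ≤ ∏ i, a i * b i := Finset.prod_nonneg fun i _ => mul_nonneg (ha i) (hb i)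
    apply le_min
    · gcongr
      linarith [neg_abs_le u]
    · gcongr
      linarith [le_abs_self u]
  · push Not at h
    obtain ⟨i, hi⟩ := h
    have : a i * b i = 0 := by
      rcases (ha i).eq_or_lt with h | h
      · rw [← h, zero_mul]
      · rw [le_antisymm (hi h) (hb i), mul_zero]
    rw [Finset.prod_eq_zero (Finset.mem_univ i) this, zero_mul]
    apply le_min <;> positivity

lemma fin_sum_conv (m u v : ℕ) (huv : u ≤ v) (hv : v < m) (g : ℕ → ℕ → ℝ) (f : Fin m → ℝ)
    (hf : ∀ j : Fin m, f j = if u ≤ j ∧ (j : ℕ) ≤ v then g (j - u) (v - j) else 0) :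
    ∑ j, f j = ∑ p ∈ Finset.HasAntidiagonal.antidiagonal (v - u), g p.1 p.2 := by
  simp only [hf]
  rw [Fin.sum_univ_eq_sum_range
    (fun j => if u ≤ j ∧ j ≤ v then g (j - u) (v - j) else 0) m, ← Finset.sum_filter,
    Finset.Nat.sum_antidiagonal_eq_sum_range_succ]
  symm
  apply Finset.sum_bij (fun i _ => i + u)
  · intro i hi
    simp only [Finset.mem_range, Finset.mem_filter] at hi ⊢
    omega
  · intro i _ j _ h; omega
  · intro j hj
    simp only [Finset.mem_range, Finset.mem_filter] at hj
    exact ⟨j - u, by simp only [Finset.mem_range]; omega, by omega⟩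
  · intro i hi
    simp only [Finset.mem_range] at hi
    congr 1 <;> omega

/-- one-dimensional weight -/
noncomputable def wt (u v : ℕ) : ℝ := if u ≤ v then cbs (v - u) else 0

lemma wt_nonneg (u v : ℕ) : 0 ≤ wt u v := by
  unfold wt; split_ifs
  · exact (cbs_pos _).le
  · exact le_rfl

/-- one-dimensional integer weight -/
def nwt (m u v : ℕ) : ℕ := if u ≤ v then Nat.centralBinom (v - u) ^ 2 * 16 ^ (m - (v - u)) else 0

lemma nwt_cast (m u v : ℕ) (hv : v ≤ m) : (nwt m u v : ℝ) = 16 ^ m * wt u v ^ 2 := by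
  unfold nwt wt
  split_ifs with h
  · unfold cbs
    have : (16 : ℝ) ^ m = 16 ^ (m - (v - u)) * 16 ^ (v - u) := by
      rw [← pow_add]; congr 1; omega
    rw [this]
    push_cast
    have h16 : (16 : ℝ) ^ (v - u) = (4 ^ (v - u)) ^ 2 := by
      rw [← pow_mul, mul_comm, pow_mul]; norm_num
    rw [h16]
    field_simp
  · simp

lemma wt_cover {m d : ℕ} (hd : 1 ≤ d) (x y : Fin d → Fin m) (hxy : x ≤ y) :
    Real.exp (-((5120 + 1) / 4 * √(d : ℝ))) ≤
      ∑ z : Fin d → Fin m, min (∏ i, wt (x i) (z i) ^ 2) (∏ i, wt (z i) (y i) ^ 2) := by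
  haveI : Nonempty (Fin d) := ⟨⟨0, hd⟩⟩
  have hle : ∀ i, (x i : ℕ) ≤ y i := fun i => hxy i
  have hsplit : ∀ (i : Fin d) (g : ℝ → ℝ → ℝ) (j : Fin m),
      (wt (x i) j * wt j (y i)) * g (wt (x i) j) (wt j (y i)) =
      if (x i : ℕ) ≤ j ∧ (j : ℕ) ≤ y i then
        (cbs (j - x i) * cbs (y i - j)) * g (cbs (j - x i)) (cbs (y i - j)) else 0 := by
    intro i g j
    unfold wt
    by_cases h1 : (x i : ℕ) ≤ j <;> by_cases h2 : (j : ℕ) ≤ y i <;> simp [h1, h2]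
  have h := exp_moment (ι := Fin d) (κ := Fin m)
    (fun i j => wt (x i) j * wt j (y i))
    (fun i j => Real.log (wt (x i) j ^ 2) - Real.log (wt j (y i) ^ 2))
    (fun i j => mul_nonneg (wt_nonneg _ _) (wt_nonneg _ _)) ?_ ?_ 5120 ?_
  · rw [Fintype.card_fin] at h
    refine h.trans (Finset.sum_le_sum fun z _ => ?_)
    exact min_ge (fun i => wt (x i) (z i)) (fun i => wt (z i) (y i))
      (fun i => wt_nonneg _ _) (fun i => wt_nonneg _ _)
  · intro i
    rw [fin_sum_conv m (x i) (y i) (hle i) (y i).2 (fun a b => (cbs a * cbs b) * 1) _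
      (fun j => by simpa using hsplit i (fun _ _ => 1) j)]
    simpa using cbs_conv _
  · intro i
    rw [fin_sum_conv m (x i) (y i) (hle i) (y i).2
      (fun a b => (cbs a * cbs b) * (Real.log (cbs a ^ 2) - Real.log (cbs b ^ 2))) _
      (fun j => hsplit i (fun a b => Real.log (a ^ 2) - Real.log (b ^ 2)) j)]
    exact cbs_mean _
  · intro i
    rw [fin_sum_conv m (x i) (y i) (hle i) (y i).2
      (fun a b => (cbs a * cbs b) * (Real.log (cbs a ^ 2) - Real.log (cbs b ^ 2)) ^ 2) _
      (fun j => hsplit i (fun a b => (Real.log (a ^ 2) - Real.log (b ^ 2)) ^ 2) j)]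
    exact cbs_var _

lemma wt_row {m : ℕ} (u : Fin m) :
    ∑ j : Fin m, wt u j ^ 2 ≤ ∑ j ∈ Finset.range m, cbs j ^ 2 := by
  rw [Fin.sum_univ_eq_sum_range (fun j => wt u j ^ 2) m]
  have h0 : ∑ j ∈ Finset.range m, wt u j ^ 2
      = ∑ j ∈ (Finset.range m).filter (fun j => (u : ℕ) ≤ j), cbs (j - u) ^ 2 := by
    rw [Finset.sum_filter]
    apply Finset.sum_congr rfl
    intro j _
    unfold wt
    split_ifs <;> simp
  rw [h0, ← Finset.sum_image (f := fun j => cbs j ^ 2) (g := fun j => j - (u : ℕ))]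
  · apply Finset.sum_le_sum_of_subset_of_nonneg
    · intro k hk
      simp only [Finset.mem_image, Finset.mem_filter, Finset.mem_range] at hk ⊢
      obtain ⟨a, ha, rfl⟩ := hk
      omega
    · intros; positivity
  · intro a ha b hb hab
    simp only [Finset.coe_filter, Finset.mem_range, Set.mem_ofPred_eq] at ha hb
    simp only at hab
    omega

lemma wt_total (m d : ℕ) :
    ∑ x : Fin d → Fin m, ∑ z : Fin d → Fin m, ∏ i, wt (x i) (z i) ^ 2 ≤
      (m : ℝ) ^ d * (∑ j ∈ Finset.range m, cbs j ^ 2) ^ d := by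
  have h : ∀ x : Fin d → Fin m, ∑ z : Fin d → Fin m, ∏ i, wt (x i) (z i) ^ 2 ≤
      (∑ j ∈ Finset.range m, cbs j ^ 2) ^ d := by
    intro x
    have e := Finset.prod_univ_sum (fun _ : Fin d => (Finset.univ : Finset (Fin m)))
      (fun i j => wt (x i) j ^ 2)
    simp only [Fintype.piFinset_univ] at e
    rw [← e]
    calc ∏ i, ∑ j : Fin m, wt (x i) j ^ 2
        ≤ ∏ _i : Fin d, ∑ j ∈ Finset.range m, cbs j ^ 2 :=
          Finset.prod_le_prod (fun i _ => by positivity) (fun i _ => wt_row (x i))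
      _ = _ := by simp
  calc _ ≤ ∑ _x : Fin d → Fin m, (∑ j ∈ Finset.range m, cbs j ^ 2) ^ d :=
        Finset.sum_le_sum fun x _ => h x
    _ = _ := by simp

lemma reach_le {m d : ℕ} {x y : Fin d → Fin m}
    (h : Relation.ReflTransGen (hypergridEdge m d) x y) : x ≤ y := by
  induction h with
  | refl => exact le_rfl
  | tail _ h2 ih =>
    refine ih.trans ?_
    obtain ⟨t, h3, h4⟩ := h2
    intro s
    by_cases hs : s = t
    · subst hs
      rw [Fin.le_def]; omega
    · exact (h4 s hs).le

lemma le_reach {m d : ℕ} (n : ℕ) : ∀ x y : Fin d → Fin m, x ≤ y →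
    ∑ i, ((y i : ℕ) - (x i : ℕ)) = n → Relation.ReflTransGen (hypergridEdge m d) x y := by
  induction n with
  | zero =>
    intro x y hxy hs
    have : x = y := by
      funext i
      have h1 := (Finset.sum_eq_zero_iff.mp hs) i (Finset.mem_univ i)
      have h2 : (x i : ℕ) ≤ y i := hxy i
      apply Fin.ext; omega
    rw [this]
  | succ n ih =>
    intro x y hxy hs
    obtain ⟨t, ht⟩ : ∃ t, (x t : ℕ) < y t := by
      by_contra hcon
      push Not at hcon
      have : ∑ i, ((y i : ℕ) - (x i : ℕ)) = 0 :=
        Finset.sum_eq_zero fun i _ => Nat.sub_eq_zero_of_le (hcon i)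
      omega
    have hlt : (x t : ℕ) + 1 < m := lt_of_le_of_lt ht (y t).2
    let x' : Fin d → Fin m := Function.update x t ⟨x t + 1, hlt⟩
    have hx't : (x' t : ℕ) = x t + 1 := by simp [x']
    have hx's : ∀ s, s ≠ t → x' s = x s := fun s hs => by simp [x', hs]
    refine Relation.ReflTransGen.head (b := x') ⟨t, hx't, fun s hs => (hx's s hs).symm⟩ ?_
    apply ih
    · intro s
      by_cases hs : s = t
      · subst hs; rw [Fin.le_def]; omega
      · rw [hx's s hs]; exact hxy s
    · rw [← Finset.add_sum_erase _ _ (Finset.mem_univ t)] at hs ⊢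
      have : ∑ i ∈ Finset.univ.erase t, ((y i : ℕ) - (x' i : ℕ))
          = ∑ i ∈ Finset.univ.erase t, ((y i : ℕ) - (x i : ℕ)) := by
        apply Finset.sum_congr rfl
        intro i hi
        rw [hx's i (Finset.ne_of_mem_erase hi)]
      rw [this]; omega

lemma absorb : ∃ M : ℝ, 0 < M ∧ ∀ d : ℕ,
    (0.97 : ℝ) ^ d * Real.exp ((5120 + 1) / 4 * √(d : ℝ)) ≤ M := by
  set g : ℝ := -Real.log 0.97 with hg
  have hgpos : 0 < g := by
    rw [hg]; exact neg_pos.2 (Real.log_neg (by norm_num) (by norm_num))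
  set α : ℝ := (5120 + 1) / 4
  refine ⟨Real.exp (α ^ 2 / (4 * g)), Real.exp_pos _, fun d => ?_⟩
  have h1 : (0.97 : ℝ) ^ d = Real.exp (-(g * d)) := by
    have : -(g * d) = d * Real.log 0.97 := by rw [hg]; ring
    rw [this, Real.exp_nat_mul, Real.exp_log (by norm_num)]
  rw [h1, ← Real.exp_add]
  apply Real.exp_le_exp.2
  have hs : √(d : ℝ) ^ 2 = d := Real.sq_sqrt (by positivity)
  set r := √(d : ℝ)
  rw [← hs]
  have : α ^ 2 / (4 * g) - (-(g * r ^ 2) + α * r) = (2 * g * r - α) ^ 2 / (4 * g) := by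
    field_simp; ring
  have : 0 ≤ (2 * g * r - α) ^ 2 / (4 * g) := by positivity
  linarith

/-- There is a constant `c` such that the directed hypergrid `[m]^d` has a 2-TC-spanner with
at most `c·K·m^d·H_m^(d-1)·d²·(log₂ m)²` edges, where `H_m` is the `m`-th harmonic number
and `K = e^(d/(H_m/2 + 1))·2^(-d)`. -/
theorem stmt17 :
    ∃ c : ℝ, ∀ m d : ℕ, 2 ≤ m → 1 ≤ d →
      ∃ H : (Fin d → Fin m) → (Fin d → Fin m) → Prop,
        IsTCSpanner (hypergridEdge m d) H 2 ∧
        (({p : (Fin d → Fin m) × (Fin d → Fin m) | H p.1 p.2}).ncard : ℝ) ≤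
          c * (Real.exp ((d : ℝ) / ((∑ i ∈ Finset.Icc 1 m, (1 : ℝ) / i) / 2 + 1)) / 2 ^ d) *
            (m : ℝ) ^ d * (∑ i ∈ Finset.Icc 1 m, (1 : ℝ) / i) ^ (d - 1) *
            (d : ℝ) ^ 2 * (Real.logb 2 m) ^ 2 := by
  classical
  obtain ⟨M, hM0, hM⟩ := absorb
  refine ⟨12 * M, fun m d hm hd => ?_⟩
  set Q : ℝ := ((16 : ℝ) ^ m) ^ d with hQ
  have hQ0 : 0 < Q := by positivity
  set β : ℝ := Real.exp (-((5120 + 1) / 4 * √(d : ℝ))) with hβ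
  have hβ0 : 0 < β := Real.exp_pos _
  let c : (Fin d → Fin m) → (Fin d → Fin m) → ℕ := fun x z => ∏ i, nwt m (x i) (z i)
  have hc : ∀ x z, (c x z : ℝ) = Q * ∏ i, wt (x i) (z i) ^ 2 := by
    intro x z
    simp only [c]
    push_cast
    rw [Finset.prod_congr rfl (fun i _ => nwt_cast m (x i) (z i) (z i).2.le),
      Finset.prod_mul_distrib]
    simp [hQ]
  have hcpos : ∀ x z, 0 < c x z → x ≤ z := by
    intro x z h i
    by_contra hcon
    have : c x z = 0 := by
      apply Finset.prod_eq_zero (Finset.mem_univ i)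
      unfold nwt
      exact if_neg hcon
    omega
  let U : Finset ((Fin d → Fin m) × (Fin d → Fin m)) := Finset.univ.filter (fun p => p.1 ≤ p.2)
  obtain ⟨E, hE1, hE2, hE3⟩ := greedy c (Q * β) (by positivity) U.card U rfl (by
    intro p hp
    have hp' : p.1 ≤ p.2 := (Finset.mem_filter.mp hp).2
    have h := wt_cover hd p.1 p.2 hp'
    have h2 := mul_le_mul_of_nonneg_left h hQ0.le
    refine h2.trans (le_of_eq ?_)
    rw [Finset.mul_sum]
    apply Finset.sum_congr rfl
    intro z _
    rw [Nat.cast_min, hc, hc, mul_min_of_nonneg _ _ hQ0.le])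
  refine ⟨fun u v => (u, v) ∈ E ∧ u ≠ v, ⟨?_, ?_⟩, ?_⟩
  · rintro u v ⟨h1, h2⟩
    refine ⟨h2, ?_⟩
    have h3 := le_reach _ u v (hcpos _ _ (hE1 _ h1)) rfl
    rcases Relation.reflTransGen_iff_eq_or_transGen.mp h3 with h | h
    · exact absurd h.symm h2
    · exact h
  · intro u v huv
    obtain ⟨z, h1, h2⟩ := hE2 (u, v) (by simpa [U] using reach_le huv)
    simp only at h1 h2
    simp only [distLE]
    by_cases huz : u = z
    · subst huz
      by_cases huv' : u = v
      · exact Or.inl huv'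
      · exact Or.inr ⟨v, ⟨h2, huv'⟩, Or.inl rfl⟩
    · by_cases hzv : z = v
      · subst hzv
        exact Or.inr ⟨z, ⟨h1, huz⟩, Or.inl rfl⟩
      · exact Or.inr ⟨z, ⟨h1, huz⟩, Or.inr ⟨v, ⟨h2, hzv⟩, rfl⟩⟩
  · have hcard : (({p : (Fin d → Fin m) × (Fin d → Fin m) | (p.1, p.2) ∈ E ∧ p.1 ≠ p.2}).ncard : ℝ)
        ≤ E.card := by
      have : ({p : (Fin d → Fin m) × (Fin d → Fin m) | (p.1, p.2) ∈ E ∧ p.1 ≠ p.2}).ncard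
          ≤ (E : Set ((Fin d → Fin m) × (Fin d → Fin m))).ncard :=
        Set.ncard_le_ncard (fun p hp => hp.1) E.finite_toSet
      rw [Set.ncard_coe_finset] at this
      exact_mod_cast this
    refine hcard.trans (hE3.trans ?_)
    set h : ℝ := ∑ i ∈ Finset.Icc 1 m, (1 : ℝ) / i with hh
    have hh1 : 1.5 ≤ h := harm_ge m hm
    have hh2 : h ≤ 1 + Real.log m := harm_le m
    set L := Real.logb 2 m with hL
    have hm' : (2 : ℝ) ≤ m := by exact_mod_cast hm
    have hd' : (1 : ℝ) ≤ d := by exact_mod_cast hd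
    have hL1 : 1 ≤ L := by
      rw [hL, Real.le_logb_iff_rpow_le (by norm_num) (by linarith)]
      simpa using hm'
    have hlog0 : 0 ≤ Real.log m := Real.log_nonneg (by linarith)
    have hlogL : Real.log m ≤ L := by
      rw [hL, Real.logb, le_div_iff₀ (Real.log_pos (by norm_num))]
      have : Real.log 2 ≤ 1 := by
        have := Real.log_le_sub_one_of_pos (show (0 : ℝ) < 2 by norm_num); linarith
      nlinarith
    have hharm : ((harmonic U.card : ℚ) : ℝ) ≤ 3 * d * L := by
      have h1 := harmonic_le_one_add_log U.card
      have h2 : Real.log U.card ≤ 2 * d * Real.log m := by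
        rcases Nat.eq_zero_or_pos U.card with h0 | h0
        · rw [h0]; simp; positivity
        · have h3 : (U.card : ℝ) ≤ (m : ℝ) ^ (2 * d) := by
            have : U.card ≤ m ^ (2 * d) := by
              refine (Finset.card_le_univ U).trans (le_of_eq ?_)
              simp [two_mul, pow_add]
            exact_mod_cast this
          have h4 := Real.log_le_log (by exact_mod_cast h0) h3
          rw [Real.log_pow] at h4
          push_cast at h4
          linarith
      have h5 : 2 * d * Real.log m ≤ 2 * d * L := by gcongr
      have h6 : 1 ≤ d * L := by nlinarith
      linarith
    have hC : ∑ x, ∑ z, (c x z : ℝ) ≤ Q * ((m : ℝ) ^ d * (0.97 ^ d * (h / 2) ^ d *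
        Real.exp ((d : ℝ) / (h / 2 + 1)))) := by
      simp only [hc, ← Finset.mul_sum]
      apply mul_le_mul_of_nonneg_left _ hQ0.le
      refine (wt_total m d).trans ?_
      gcongr
      have hS := (cbs_sum_le m hm).trans (slack h hh1)
      calc (∑ j ∈ Finset.range m, cbs j ^ 2) ^ d
          ≤ (0.97 * (h / 2 * Real.exp (1 / (h / 2 + 1)))) ^ d := by gcongr
        _ = 0.97 ^ d * (h / 2) ^ d * Real.exp (1 / (h / 2 + 1)) ^ d := by
            rw [mul_pow, mul_pow, mul_assoc]
        _ = _ := by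
            rw [← Real.exp_nat_mul, mul_one_div]
    set X : ℝ := Real.exp ((d : ℝ) / (h / 2 + 1)) with hX
    have hX0 : 0 < X := Real.exp_pos _
    have hβinv : Real.exp ((5120 + 1) / 4 * √(d : ℝ)) = 1 / β := by
      rw [hβ, Real.exp_neg, one_div, inv_inv]
    have hMd := hM d
    rw [hβinv] at hMd
    have hhpow : h ^ d = h ^ (d - 1) * h := by
      rw [← pow_succ]; congr 1; omega
    have hh0 : 0 < h := by linarith
    calc 2 * (∑ x, ∑ z, (c x z : ℝ)) / (Q * β) * ((harmonic U.card : ℚ) : ℝ)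
        ≤ 2 * (Q * ((m : ℝ) ^ d * (0.97 ^ d * (h / 2) ^ d * X))) / (Q * β) * (3 * d * L) := by
          have hharm0 : (0 : ℝ) ≤ ((harmonic U.card : ℚ) : ℝ) := by
            have : (0 : ℚ) ≤ harmonic U.card := by unfold harmonic; positivity
            exact_mod_cast this
          gcongr
      _ = 6 * (0.97 ^ d * (1 / β)) * (X / 2 ^ d) * (m : ℝ) ^ d * h ^ (d - 1) * (h * d * L) := by
          rw [div_pow, hhpow]; field_simp; norm_num
      _ ≤ 6 * M * (X / 2 ^ d) * (m : ℝ) ^ d * h ^ (d - 1) * ((2 * L) * (d * d) * L) := by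
          gcongr
          · linarith
          · nlinarith
      _ = _ := by ring
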